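/- arXiv:1709.06403 — 3 statements merged into one kernel-verified Lean document; each statement's English description precedes it below -/
import Mathlib

section
/- Let (S, ◁) be a continuous basic cover. A subset V ⊆ S is located if and only if the corresponding basic cover map r_V : 1 → (S, ◁) (defined by ∗ r_V a iff a ∈ V) is a perfect map. Consequently, the located subsets of (S, ◁) are in bijective correspondence with the perfect basic cover maps from the terminal basic cover 1 to (S, ◁). -/
noncomputable section
open Classical

universe u v

namespace FTP

/-! ### Basic covers -/

/-- `U ◁ V` : every element of `U` is covered by `V`. -/
def covS {S : Type*} (cov : S → Set S → Prop) (U V : Set S) : Prop :=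
  ∀ a ∈ U, cov a V

/-- A basic cover: reflexivity and transitivity. -/
def IsBasicCover {S : Type*} (cov : S → Set S → Prop) : Prop :=
  (∀ (a : S) (U : Set S), a ∈ U → cov a U) ∧
  (∀ (a : S) (U V : Set S), cov a U → covS cov U V → cov a V)

/-- the way-below relation `a ≪ b`. -/
def wb {S : Type*} (cov : S → Set S → Prop) (a b : S) : Prop :=
  ∀ U : Set S, cov b U → ∃ U₀ : Finset S, ↑U₀ ⊆ U ∧ cov a ↑U₀

/-- the way-below relation between subsets `U ≪ V`. -/
def wbS {S : Type*} (cov : S → Set S → Prop) (U V : Set S) : Prop :=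
  ∀ W : Set S, covS cov V W → ∃ W₀ : Finset S, ↑W₀ ⊆ W ∧ covS cov U ↑W₀

/-- A continuous basic cover, with the witnessing function `w`. -/
def IsContinuous {S : Type*} (cov : S → Set S → Prop) (w : S → Set S) : Prop :=
  (∀ a : S, ∀ b ∈ w a, wb cov b a) ∧ (∀ a : S, cov a (w a))

/-- splitting subsets. -/
def Splitting {S : Type*} (cov : S → Set S → Prop) (V : Set S) : Prop :=
  ∀ (a : S) (U : Set S), a ∈ V → cov a U → (V ∩ U).Nonempty

/-- located subsets. -/
def Located {S : Type*} (cov : S → Set S → Prop) (V : Set S) : Prop :=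
  Splitting cov V ∧ ∀ a b : S, wb cov a b → a ∉ V ∨ b ∈ V

/-- inverse image of a relation. -/
def rinv {α β : Type*} (r : α → β → Prop) (U : Set β) : Set α :=
  {x | ∃ a ∈ U, r x a}

/-- basic cover maps. -/
def IsBCM {α β : Type*} (cov : α → Set α → Prop) (cov' : β → Set β → Prop)
    (r : α → β → Prop) : Prop :=
  ∀ (a : β) (U : Set β), cov' a U → covS cov (rinv r {a}) (rinv r U)

/-- perfect maps. -/
def IsPerfect {α β : Type*} (cov : α → Set α → Prop) (cov' : β → Set β → Prop)
    (r : α → β → Prop) : Prop :=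
  ∀ a b : β, wb cov' a b → wbS cov (rinv r {a}) (rinv r {b})

/-- the terminal basic cover `1 = ({∗}, ∈)`. -/
def unitCov : Unit → Set Unit → Prop := fun x U => x ∈ U

/-! ### Formal topologies -/

/-- `U ↓ V` with respect to a preorder `le`. -/
def down {S : Type*} (le : S → S → Prop) (U V : Set S) : Set S :=
  {c | ∃ a ∈ U, ∃ b ∈ V, le c a ∧ le c b}

/-- A formal topology: a basic cover together with a compatible preorder. -/
def IsFormalTopology {S : Type*} (cov : S → Set S → Prop) (le : S → S → Prop) : Prop :=
  IsBasicCover cov ∧ Reflexive le ∧ Transitive le ∧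
  (∀ a b : S, le a b → cov a {b}) ∧
  (∀ (a : S) (U V : Set S), cov a U → cov a V → cov a (down le U V))

/-- formal topology maps. -/
def IsFTM {α β : Type*} (cov : α → Set α → Prop) (le : α → α → Prop)
    (cov' : β → Set β → Prop) (le' : β → β → Prop) (r : α → β → Prop) : Prop :=
  IsBCM cov cov' r ∧
  covS cov Set.univ (rinv r Set.univ) ∧
  ∀ a b : β, covS cov (down le (rinv r {a}) (rinv r {b})) (rinv r (down le' {a} {b}))

/-- the order on maps. -/
def MapLE {α β : Type*} (cov : α → Set α → Prop) (r s : α → β → Prop) : Prop :=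
  ∀ a : β, covS cov (rinv r {a}) (rinv s {a})

/-- equality of maps. -/
def MapEq {α β : Type*} (cov : α → Set α → Prop) (r s : α → β → Prop) : Prop :=
  MapLE cov r s ∧ MapLE cov s r

/-- composition of relational maps (`comp s r = s ∘ r`). -/
def comp {α β γ : Type*} (s : β → γ → Prop) (r : α → β → Prop) : α → γ → Prop :=
  fun x c => ∃ b, r x b ∧ s b c

/-- `b* = {c | c ↓ b ◁ ∅}`. -/
def star {S : Type*} (cov : S → Set S → Prop) (le : S → S → Prop) (b : S) : Set S :=
  {c | covS cov (down le {c} {b}) ∅}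

/-- `b ⋘ a` iff `S ◁ b* ∪ {a}`. -/
def wc {S : Type*} (cov : S → Set S → Prop) (le : S → S → Prop) (b a : S) : Prop :=
  covS cov Set.univ (star cov le b ∪ {a})

/-- regular formal topologies. -/
def Regular {S : Type*} (cov : S → Set S → Prop) (le : S → S → Prop) : Prop :=
  ∀ a : S, cov a {b | wc cov le b a}

/-- compactness: `S ≪ S`. -/
def Compact {S : Type*} (cov : S → Set S → Prop) : Prop :=
  wbS cov Set.univ Set.univ

/-- stability: `a ≪ a'` and `b ≪ b'` imply `a↓b ≪ a'↓b'`. -/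
def Stable {S : Type*} (cov : S → Set S → Prop) (le : S → S → Prop) : Prop :=
  ∀ a a' b b' : S, wb cov a a' → wb cov b b' →
    wbS cov (down le {a} {b}) (down le {a'} {b'})

/-- isomorphism of formal topologies. -/
def IsIso {α β : Type*} (cov : α → Set α → Prop) (le : α → α → Prop)
    (cov' : β → Set β → Prop) (le' : β → β → Prop) : Prop :=
  ∃ (r : α → β → Prop) (s : β → α → Prop),
    IsFTM cov le cov' le' r ∧ IsFTM cov' le' cov le s ∧
    MapEq cov (comp s r) (fun a b => a = b) ∧
    MapEq cov' (comp r s) (fun a b => a = b)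

/-! ### Geometric theories and the covers they present -/

/-- the preorder `A ≤ B ↔ B ⊆ A` on finite sets of generators. -/
def supord {P : Type*} : Finset P → Finset P → Prop := fun A B => B ⊆ A

/-- The cover on `Finset P` inductively generated by a geometric theory `T`
(an axiom `T A 𝒞` means `⋀A ⊢ ⋁_{B ∈ 𝒞} ⋀B`). -/
inductive GCov {P : Type*} (T : Finset P → Set (Finset P) → Prop) :
    Finset P → Set (Finset P) → Prop where
  | refl {A : Finset P} {𝒰 : Set (Finset P)} : A ∈ 𝒰 → GCov T A 𝒰
  | le {A B : Finset P} {𝒰 : Set (Finset P)} : B ⊆ A → GCov T B 𝒰 → GCov T A 𝒰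
  | ax {A : Finset P} {𝒞 𝒰 : Set (Finset P)} (C : Finset P) :
      T A 𝒞 → (∀ B ∈ 𝒞, GCov T (C ∪ B) 𝒰) → GCov T (C ∪ A) 𝒰

theorem GCov_trans {P : Type*} {T : Finset P → Set (Finset P) → Prop}
    {A : Finset P} {𝒰 𝒱 : Set (Finset P)}
    (h : GCov T A 𝒰) (h' : ∀ B ∈ 𝒰, GCov T B 𝒱) : GCov T A 𝒱 := by
  induction h with
  | refl hA => exact h' _ hA
  | le hBA _ ih => exact GCov.le hBA (ih h')
  | ax C hT _ ih => exact GCov.ax C hT (fun B hB => ih B hB h')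

theorem GCov_isBasicCover {P : Type*} (T : Finset P → Set (Finset P) → Prop) :
    IsBasicCover (GCov T) :=
  ⟨fun _ _ h => GCov.refl h, fun _ _ _ h h' => GCov_trans h h'⟩

/-! ### The patch, Lawson and lower powerlocale theories -/

/-- generators of the patch/Lawson theories : `r a` and `l A`. -/
inductive PatchGen (S : Type u) : Type u where
  | r : S → PatchGen S
  | l : Finset S → PatchGen S

/-- The geometric theory `T_P` presenting the patch of a stably locally compact
formal topology. -/
inductive PatchThy {S : Type*} (cov : S → Set S → Prop) (le : S → S → Prop) :
    Finset (PatchGen S) → Set (Finset (PatchGen S)) → Prop where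
  | R1 : PatchThy cov le ∅ {B | ∃ a : S, B = {PatchGen.r a}}
  | R2 (a b : S) :
      PatchThy cov le {PatchGen.r a, PatchGen.r b}
        {B | ∃ c ∈ down le {a} {b}, B = {PatchGen.r c}}
  | R3 (a : S) (A : Finset S) :
      cov a ↑A → PatchThy cov le {PatchGen.r a} {B | ∃ b ∈ A, B = {PatchGen.r b}}
  | R4 (a : S) :
      PatchThy cov le {PatchGen.r a} {B | ∃ b : S, wb cov b a ∧ B = {PatchGen.r b}}
  | L1 : PatchThy cov le ∅ {({PatchGen.l ∅} : Finset (PatchGen S))}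
  | L2 (A B : Finset S) :
      covS cov ↑A ↑B →
      PatchThy cov le {PatchGen.l B} {({PatchGen.l A} : Finset (PatchGen S))}
  | L3 (A B : Finset S) :
      PatchThy cov le {PatchGen.l A, PatchGen.l B}
        {D | ∃ C : Finset S, wbS cov ↑A ↑C ∧ wbS cov ↑B ↑C ∧ D = {PatchGen.l C}}
  | Loc (a b : S) :
      wb cov a b →
      PatchThy cov le ∅
        {({PatchGen.l {a}} : Finset (PatchGen S)), ({PatchGen.r b} : Finset (PatchGen S))}
  | D (a : S) :
      PatchThy cov le {PatchGen.l {a}, PatchGen.r a} (∅ : Set (Finset (PatchGen S)))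

/-- the cover of `Patch(S)`. -/
def patchCov {S : Type*} (cov : S → Set S → Prop) (le : S → S → Prop) :
    Finset (PatchGen S) → Set (Finset (PatchGen S)) → Prop :=
  GCov (PatchThy cov le)

/-- the counit `ε_P : Patch(S) → S`. -/
def epsP {S : Type*} (cov : S → Set S → Prop) (le : S → S → Prop) :
    Finset (PatchGen S) → S → Prop :=
  fun 𝔄 a => patchCov cov le 𝔄 {({PatchGen.r a} : Finset (PatchGen S))}

/-- The geometric theory `T_L` presenting the Lawson topology of a continuous
basic cover (the axioms of `T_P` without (R1), (R2)). -/
inductive LawsonThy {S : Type*} (cov : S → Set S → Prop) :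
    Finset (PatchGen S) → Set (Finset (PatchGen S)) → Prop where
  | R3 (a : S) (A : Finset S) :
      cov a ↑A → LawsonThy cov {PatchGen.r a} {B | ∃ b ∈ A, B = {PatchGen.r b}}
  | R4 (a : S) :
      LawsonThy cov {PatchGen.r a} {B | ∃ b : S, wb cov b a ∧ B = {PatchGen.r b}}
  | L1 : LawsonThy cov ∅ {({PatchGen.l ∅} : Finset (PatchGen S))}
  | L2 (A B : Finset S) :
      covS cov ↑A ↑B →
      LawsonThy cov {PatchGen.l B} {({PatchGen.l A} : Finset (PatchGen S))}
  | L3 (A B : Finset S) :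
      LawsonThy cov {PatchGen.l A, PatchGen.l B}
        {D | ∃ C : Finset S, wbS cov ↑A ↑C ∧ wbS cov ↑B ↑C ∧ D = {PatchGen.l C}}
  | Loc (a b : S) :
      wb cov a b →
      LawsonThy cov ∅
        {({PatchGen.l {a}} : Finset (PatchGen S)), ({PatchGen.r b} : Finset (PatchGen S))}
  | D (a : S) :
      LawsonThy cov {PatchGen.l {a}, PatchGen.r a} (∅ : Set (Finset (PatchGen S)))

/-- the cover of the Lawson topology `L(S)`. -/
def lawsonCov {S : Type*} (cov : S → Set S → Prop) :
    Finset (PatchGen S) → Set (Finset (PatchGen S)) → Prop :=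
  GCov (LawsonThy cov)

/-- the counit `ε_L : L(S) → S`. -/
def epsL {S : Type*} (cov : S → Set S → Prop) : Finset (PatchGen S) → S → Prop :=
  fun 𝔄 a => lawsonCov cov 𝔄 {({PatchGen.r a} : Finset (PatchGen S))}

/-- The theory presenting the lower powerlocale of a continuous basic cover:
generators `a ∈ S`, axioms (R3) and (R4). -/
inductive LowerThy {S : Type*} (cov : S → Set S → Prop) :
    Finset S → Set (Finset S) → Prop where
  | R3 (a : S) (A : Finset S) :
      cov a ↑A → LowerThy cov {a} {B | ∃ b ∈ A, B = ({b} : Finset S)}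
  | R4 (a : S) :
      LowerThy cov {a} {B | ∃ b : S, wb cov b a ∧ B = ({b} : Finset S)}

/-- the cover of the lower powerlocale `Lower(S)`. -/
def lowerCov {S : Type*} (cov : S → Set S → Prop) :
    Finset S → Set (Finset S) → Prop :=
  GCov (LowerThy cov)

/-- the counit `σ_L : Lower(S) → S`. -/
def sigmaL {S : Type*} (cov : S → Set S → Prop) : Finset S → S → Prop :=
  fun A a => lowerCov cov A ({({a} : Finset S)} : Set (Finset S))

/-! ### de Groot duals -/

/-- `↟A = {B ∈ Fin S | A ≪ B}`. -/
def upF {S : Type*} (cov : S → Set S → Prop) (A : Finset S) : Set (Finset S) :=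
  {B | wbS cov ↑A ↑B}

/-- the finite join `⋁^F {↟A | A ∈ 𝒜}` of Scott open filters. -/
def finJoin {S : Type*} (cov : S → Set S → Prop) (le : S → S → Prop)
    (𝒜 : Finset (Finset S)) : Set (Finset S) :=
  if 𝒜 = ∅ then {B | covS cov Set.univ ↑B}
  else {B | ∃ g : Finset S → Finset S,
    (∀ A ∈ 𝒜, wbS cov ↑A ↑(g A)) ∧
    wbS cov {c | ∀ A ∈ 𝒜, ∃ b ∈ g A, le c b} ↑B}

/-- The cover `◁^D` of the de Groot dual `S^D`, inductively generated on
`(Fin S, ⊇)` by the axioms (D3) `A ◁ ↟A` and (D4). -/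
inductive DCov {S : Type*} (cov : S → Set S → Prop) (le : S → S → Prop) :
    Finset S → Set (Finset S) → Prop where
  | refl {A : Finset S} {𝒰 : Set (Finset S)} : A ∈ 𝒰 → DCov cov le A 𝒰
  | le {A B : Finset S} {𝒰 : Set (Finset S)} :
      B ⊆ A → DCov cov le B 𝒰 → DCov cov le A 𝒰
  | d3 {A A' : Finset S} {𝒰 : Set (Finset S)} :
      A ⊆ A' →
      (∀ C : Finset S, A' ⊆ C → (∃ B : Finset S, wbS cov ↑A ↑B ∧ B ⊆ C) →
        DCov cov le C 𝒰) →
      DCov cov le A' 𝒰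
  | d4 {A A' : Finset S} {𝒜 : Finset (Finset S)} {𝒰 : Set (Finset S)} :
      A ⊆ A' → upF cov A ⊆ finJoin cov le 𝒜 →
      (∀ C : Finset S, A' ⊆ C → (∃ B ∈ 𝒜, B ⊆ C) → DCov cov le C 𝒰) →
      DCov cov le A' 𝒰

/-- the cover of the Scott topology `Σ(S)` on `(Fin S, ⊇)`. -/
def scottCov {S : Type*} (cov : S → Set S → Prop) :
    Finset S → Set (Finset S) → Prop :=
  fun A 𝒰 => upF cov A ⊆ ⋃ B ∈ 𝒰, upF cov B

/-- a filter (with respect to `◁`) of basic opens, given by a set of finite subsets. -/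
def IsCovFilter {S : Type*} (cov : S → Set S → Prop) (le : S → S → Prop)
    (𝒱 : Set (Finset S)) : Prop :=
  𝒱.Nonempty ∧
  (∀ A ∈ 𝒱, ∀ B : Finset S, covS cov ↑A ↑B → B ∈ 𝒱) ∧
  (∀ A ∈ 𝒱, ∀ B ∈ 𝒱, ∃ C ∈ 𝒱, covS cov ↑C (down le ↑A ↑B))

/-- The geometric theory `T^d` presenting the de Groot dual `S^d`:
generators `l A` (identified with `A : Finset S`), axioms (L1)–(L3) and (D4). -/
inductive DGThy {S : Type*} (cov : S → Set S → Prop) (le : S → S → Prop) :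
    Finset (Finset S) → Set (Finset (Finset S)) → Prop where
  | L1 : DGThy cov le ∅ {({(∅ : Finset S)} : Finset (Finset S))}
  | L2 (A B : Finset S) :
      covS cov ↑A ↑B → DGThy cov le {B} {({A} : Finset (Finset S))}
  | L3 (A B : Finset S) :
      DGThy cov le {A, B}
        {D | ∃ C : Finset S, wbS cov ↑A ↑C ∧ wbS cov ↑B ↑C ∧ D = ({C} : Finset (Finset S))}
  | D4 (A : Finset S) (𝒜 : Finset (Finset S)) :
      upF cov A ⊆ finJoin cov le 𝒜 →
      DGThy cov le {A} {D | ∃ B ∈ 𝒜, D = ({B} : Finset (Finset S))}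

/-! ### Spectral formal topologies -/

/-- spectral formal topologies: a compatible meet-semilattice structure on the
base, with every basic element way-below itself. -/
def IsSpectral {S : Type*} (cov : S → Set S → Prop) (le : S → S → Prop)
    (one : S) (meet : S → S → S) : Prop :=
  (∀ a : S, cov a {one}) ∧
  (∀ a b : S, cov (meet a b) (down le {a} {b})) ∧
  (∀ a b : S, ∀ c ∈ down le {a} {b}, cov c {meet a b}) ∧
  (∀ a : S, wb cov a a)

/-! ### Subtopologies -/

/-- the property of being a formal-topology cover compatible with `le`. -/
def IsFTCover {S : Type*} (cov : S → Set S → Prop) (le : S → S → Prop) : Prop :=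
  IsBasicCover cov ∧ (∀ a b : S, le a b → cov a {b}) ∧
  (∀ (a : S) (U V : Set S), cov a U → cov a V → cov a (down le U V))

/-- The meet (in `SubTop(S)`) of a family of subtopology covers: the least
formal-topology cover containing all of them. -/
def covMeet {S : Type*} {ι : Sort*} (le : S → S → Prop)
    (F : ι → (S → Set S → Prop)) : S → Set S → Prop :=
  fun a U => ∀ c : S → Set S → Prop,
    IsFTCover c le → (∀ i : ι, ∀ (a' : S) (U' : Set S), F i a' U' → c a' U') → c a U

/-- the closed subtopology `C_a` determined by `{a}`. -/
def closedCov {S : Type*} (cov : S → Set S → Prop) (a : S) : S → Set S → Prop :=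
  fun c V => cov c ({a} ∪ V)

/-- the open subtopology `S_B` determined by a finite `B`. -/
def openCov {S : Type*} (cov : S → Set S → Prop) (le : S → S → Prop)
    (B : Finset S) : S → Set S → Prop :=
  fun c V => covS cov (down le {c} ↑B) V

/-- `K_A = ⋀_{A ≪ B} S_B`. -/
def KCov {S : Type*} (cov : S → Set S → Prop) (le : S → S → Prop) (A : Finset S) :
    S → Set S → Prop :=
  covMeet le (fun B : {B : Finset S // wbS cov ↑A ↑B} => openCov cov le B.1)

/-- `C_a ∨ K_A` (the join of subtopologies is the intersection of covers). -/
def CKCov {S : Type*} (cov : S → Set S → Prop) (le : S → S → Prop)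
    (a : S) (A : Finset S) : S → Set S → Prop :=
  fun c V => closedCov cov a c V ∧ KCov cov le A c V

/-- perfect subtopologies. -/
def IsPerfectSub {S : Type*} (cov : S → Set S → Prop) (le : S → S → Prop)
    (cov' : S → Set S → Prop) : Prop :=
  IsFTCover cov' le ∧ (∀ (a : S) (U : Set S), cov a U → cov' a U) ∧
  (∀ a b : S, wb cov a b → wb cov' a b)

/-- the order of `PSub(S)`: `(a,A) ≤ (b,B)` iff `C_b ∨ K_B ⊑ C_a ∨ K_A`. -/
def PSubLe {S : Type*} (cov : S → Set S → Prop) (le : S → S → Prop) :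
    S × Finset S → S × Finset S → Prop :=
  fun p q => ∀ (c : S) (V : Set S), CKCov cov le p.1 p.2 c V → CKCov cov le q.1 q.2 c V

/-- the cover of `PSub(S)`: `(a,A) ◁ U` iff `⋀{C_b ∨ K_B | (b,B) ∈ U} ⊑ C_a ∨ K_A`. -/
def covPSub {S : Type*} (cov : S → Set S → Prop) (le : S → S → Prop) :
    S × Finset S → Set (S × Finset S) → Prop :=
  fun p U => ∀ (c : S) (V : Set S), CKCov cov le p.1 p.2 c V →
    covMeet le (fun q : U => CKCov cov le q.1.1 q.1.2) c V

/-- the map `r : PSub(S) → Patch(S)` on generators. -/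
def rGenPS {S : Type*} (cov : S → Set S → Prop) (le : S → S → Prop)
    (p : S × Finset S) : PatchGen S → Prop
  | PatchGen.r b => covPSub cov le p {((b, (∅ : Finset S)) : S × Finset S)}
  | PatchGen.l B => covPSub cov le p {q : S × Finset S | q.2 = B}

/-- the map `r : PSub(S) → Patch(S)`, extended along the presentation. -/
def rPS {S : Type*} (cov : S → Set S → Prop) (le : S → S → Prop) :
    S × Finset S → Finset (PatchGen S) → Prop :=
  fun p 𝔅 => ∀ g ∈ 𝔅, covPSub cov le p (rinv (fun q g' => rGenPS cov le q g') {g})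

/-- the map `s : Patch(S) → PSub(S)`. -/
def sPS {S : Type*} (cov : S → Set S → Prop) (le : S → S → Prop) :
    Finset (PatchGen S) → (S × Finset S) → Prop :=
  fun 𝔄 p => patchCov cov le 𝔄
    ({({PatchGen.r p.1, PatchGen.l p.2} : Finset (PatchGen S))} : Set (Finset (PatchGen S)))

/-! ### Saturated subsets, dcpos and preframes -/

/-- the saturated subsets of a basic cover. -/
abbrev SatSet {α : Type*} (cov : α → Set α → Prop) : Type _ :=
  {U : Set α // ∀ a, cov a U → a ∈ U}

/-- the join of a family of saturated subsets. -/
def satSup {α : Type*} {cov : α → Set α → Prop} (hbc : IsBasicCover cov)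
    (D : Set (SatSet cov)) : SatSet cov :=
  ⟨{a | cov a (⋃ U ∈ D, (U : Set α))}, fun a h => hbc.2 a _ _ h (fun _ hb => hb)⟩

/-- inductively generated basic covers: `BGen Ax` is the cover generated by the
axiom-set with axioms `a ◁ C` for `C ∈ Ax a`. -/
inductive BGen {S : Type*} (Ax : S → Set (Set S)) : S → Set S → Prop where
  | refl {a : S} {U : Set S} : a ∈ U → BGen Ax a U
  | infty {a : S} {U : Set S} (C : Set S) :
      C ∈ Ax a → (∀ b ∈ C, BGen Ax b U) → BGen Ax a U

theorem BGen_trans {S : Type*} {Ax : S → Set (Set S)} {a : S} {U V : Set S}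
    (h : BGen Ax a U) (h' : ∀ b ∈ U, BGen Ax b V) : BGen Ax a V := by
  induction h with
  | refl ha => exact h' _ ha
  | infty C hC _ ih => exact BGen.infty C hC (fun b hb => ih b hb h')

theorem BGen_isBasicCover {S : Type*} (Ax : S → Set (Set S)) :
    IsBasicCover (BGen Ax) :=
  ⟨fun _ _ h => BGen.refl h, fun _ _ _ h h' => BGen_trans h h'⟩

/-- the lower powerlocale theory of an inductively generated basic cover. -/
inductive LowerThyAx {S : Type*} (Ax : S → Set (Set S)) :
    Finset S → Set (Finset S) → Prop where
  | mk (a : S) (C : Set S) :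
      C ∈ Ax a → LowerThyAx Ax {a} {B | ∃ b ∈ C, B = ({b} : Finset S)}

/-- the counit `σ_L : Lower(S) → S` for an inductively generated basic cover. -/
def sigmaLAx {S : Type*} (Ax : S → Set (Set S)) : Finset S → S → Prop :=
  fun A a => GCov (LowerThyAx Ax) A ({({a} : Finset S)} : Set (Finset S))

/-- the top saturated subset of a presented topology. -/
def satTop {P : Type*} (T : Finset P → Set (Finset P) → Prop) : SatSet (GCov T) :=
  ⟨Set.univ, fun _ _ => Set.mem_univ _⟩

/-- binary meets of saturated subsets of a presented topology. -/
def satInfL {P : Type*} (T : Finset P → Set (Finset P) → Prop)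
    (U V : SatSet (GCov T)) : SatSet (GCov T) :=
  ⟨{A | GCov T A (down supord (U : Set (Finset P)) (V : Set (Finset P)))},
   fun _ h => GCov_trans h (fun _ hB => hB)⟩

/-- the suplattice homomorphism `σ_L* : Sat(S) → Sat(Lower(S))`. -/
def sigmaStar {S : Type*} (Ax : S → Set (Set S)) (U : SatSet (BGen Ax)) :
    SatSet (GCov (LowerThyAx Ax)) :=
  ⟨{A : Finset S | GCov (LowerThyAx Ax) A (rinv (sigmaLAx Ax) (U : Set S))},
   fun _ h => GCov_trans h (fun _ hB => hB)⟩

/-- a preframe structure on a partial order: finite meets and directed joins,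
with finite meets distributing over directed joins. -/
structure PreframeStr (X : Type*) [PartialOrder X] where
  top : X
  inf : X → X → X
  dSup : Set X → X
  le_top : ∀ x, x ≤ top
  inf_le_left : ∀ x y, inf x y ≤ x
  inf_le_right : ∀ x y, inf x y ≤ y
  le_inf : ∀ x y z, x ≤ y → x ≤ z → x ≤ inf y z
  le_dSup : ∀ d : Set X, d.Nonempty → DirectedOn (· ≤ ·) d → ∀ x ∈ d, x ≤ dSup d
  dSup_le : ∀ d : Set X, d.Nonempty → DirectedOn (· ≤ ·) d →
    ∀ z, (∀ x ∈ d, x ≤ z) → dSup d ≤ z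
  distrib : ∀ (x : X) (d : Set X), d.Nonempty → DirectedOn (· ≤ ·) d →
    inf x (dSup d) = dSup ((fun y => inf x y) '' d)

/-- dcpo homomorphisms out of `Sat(S)`. -/
def IsDcpoHom {α : Type*} {cov : α → Set α → Prop} (hbc : IsBasicCover cov)
    {X : Type*} [PartialOrder X] (PF : PreframeStr X) (f : SatSet cov → X) : Prop :=
  Monotone f ∧
  ∀ D : Set (SatSet cov), D.Nonempty → DirectedOn (· ≤ ·) D →
    f (satSup hbc D) = PF.dSup (f '' D)

/-- preframe homomorphisms out of the frame of a presented topology. -/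
def IsPreframeHomL {P : Type*} (T : Finset P → Set (Finset P) → Prop)
    {X : Type*} [PartialOrder X] (PF : PreframeStr X)
    (F : SatSet (GCov T) → X) : Prop :=
  Monotone F ∧ F (satTop T) = PF.top ∧
  (∀ U V, F (satInfL T U V) = PF.inf (F U) (F V)) ∧
  ∀ D : Set (SatSet (GCov T)), D.Nonempty → DirectedOn (· ≤ ·) D →
    F (satSup (GCov_isBasicCover T) D) = PF.dSup (F '' D)

/-! ### Located subsets: auxiliary notions -/

/-- the lower part `L_V` associated to a located subset `V`. -/
def LV {S : Type*} (cov : S → Set S → Prop) (V : Set S) : Set S :=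
  {a | ∃ A : Finset S, wbS cov {a} ↑A ∧ (↑A ∩ V : Set S) = ∅}

/-- cuts of a continuous basic cover. -/
def IsCut {S : Type*} (cov : S → Set S → Prop) (L U : Set S) : Prop :=
  (∀ (a : S) (A : Finset S), cov a ↑A → a ∈ U → ((↑A : Set S) ∩ U).Nonempty) ∧
  (∀ a ∈ U, ∃ b : S, wb cov b a ∧ b ∈ U) ∧
  (∀ (a : S) (A : Finset S), cov a ↑A → (↑A : Set S) ⊆ L → a ∈ L) ∧
  (∀ a ∈ L, ∃ A : Finset S, wbS cov {a} ↑A ∧ (↑A : Set S) ⊆ L) ∧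
  (∀ a b : S, wb cov a b → a ∈ L ∨ b ∈ U) ∧
  L ∩ U = ∅

end FTP

namespace FTP

theorem isBCM_unit_iff_splitting {S : Type*} {cov : S → Set S → Prop} {V : Set S} :
    IsBCM unitCov cov (fun _ a => a ∈ V) ↔ Splitting cov V := by
  constructor
  · intro h a U ha hU
    obtain ⟨b, hb, hbV⟩ := h a U hU () ⟨a, rfl, ha⟩
    exact ⟨b, hbV, hb⟩
  · rintro h a U hU x ⟨c, rfl, hc⟩
    obtain ⟨b, hbV, hb⟩ := h c U hc hU
    exact ⟨b, hb, hbV⟩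

theorem wbS_unitCov_iff {U V : Set Unit} : wbS unitCov U V ↔ U ⊆ V := by
  constructor
  · intro h
    obtain ⟨W₀, hW₀, hU⟩ := h V fun _ hx => hx
    exact fun x hx => hW₀ (hU x hx)
  · intro h W hW
    exact ⟨W.toFinite.toFinset, by simp, fun x hx => by simpa [unitCov] using hW x (h hx)⟩

theorem isPerfect_unit_iff {S : Type*} {cov : S → Set S → Prop} {V : Set S} :
    IsPerfect unitCov cov (fun _ a => a ∈ V) ↔ ∀ a b : S, wb cov a b → a ∉ V ∨ b ∈ V := by
  simp [IsPerfect, wbS_unitCov_iff, rinv, Set.subset_def, imp_iff_not_or]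

theorem located_iff_isBCM_and_isPerfect {S : Type*} {cov : S → Set S → Prop} {V : Set S} :
    Located cov V ↔
      IsBCM unitCov cov (fun _ a => a ∈ V) ∧ IsPerfect unitCov cov (fun _ a => a ∈ V) := by
  rw [isBCM_unit_iff_splitting, isPerfect_unit_iff, Located]

/-- Let `(S, ◁)` be a continuous basic cover.  A subset `V ⊆ S` is
located iff the corresponding basic cover map `r_V : 1 → (S, ◁)` is a perfect map;
consequently the located subsets are in bijective correspondence with the perfect
basic cover maps from the terminal basic cover `1`. -/
theorem located_iff_perfect_point {S : Type u} (cov : S → Set S → Prop)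
    (hbc : IsBasicCover cov) (w : S → Set S) (hw : IsContinuous cov w) :
    (∀ V : Set S, Located cov V ↔
      (IsBCM unitCov cov (fun _ a => a ∈ V) ∧ IsPerfect unitCov cov (fun _ a => a ∈ V))) ∧
    Function.Injective
      (fun V : {V : Set S // Located cov V} => ((fun _ a => a ∈ V.1) : Unit → S → Prop)) ∧
    Set.range
      (fun V : {V : Set S // Located cov V} => ((fun _ a => a ∈ V.1) : Unit → S → Prop)) =
      {r : Unit → S → Prop | IsBCM unitCov cov r ∧ IsPerfect unitCov cov r} := by
  refine ⟨fun V => located_iff_isBCM_and_isPerfect, fun V V' h => ?_, Set.ext fun r => ?_⟩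
  · exact Subtype.ext (congrFun h ())
  · constructor
    · rintro ⟨V, rfl⟩
      exact located_iff_isBCM_and_isPerfect.mp V.2
    · intro h
      exact ⟨⟨{a | r () a}, located_iff_isBCM_and_isPerfect.mpr h⟩, rfl⟩

end FTP
end
end

section
/- Let (S, ◁) be a continuous basic cover. The assignment V ↦ (L_V, V), where L_V = {a ∈ S | there exists a finite A ⊆ S with a ≪ A and A ∩ V = ∅}, is a bijective correspondence between the located subsets of (S, ◁) and the cuts of (S, ◁). -/
noncomputable section
open Classical

universe u v

namespace FTP

section

variable {S : Type u} {cov : S → Set S → Prop}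

theorem IsBasicCover.mono (hbc : IsBasicCover cov) {a : S} {U V : Set S}
    (h : cov a U) (hUV : U ⊆ V) : cov a V :=
  hbc.2 a U V h fun b hb => hbc.1 b V (hUV hb)

theorem IsBasicCover.cov_of_wbS (hbc : IsBasicCover cov) {a : S} {A : Set S}
    (h : wbS cov {a} A) : cov a A := by
  obtain ⟨W, hWA, hW⟩ := h A fun b hb => hbc.1 b A hb
  exact hbc.mono (hW a rfl) hWA

theorem wb.wbS_of_mem {a b : S} {B : Set S} (h : wb cov a b) (hb : b ∈ B) :
    wbS cov {a} B := by
  intro W hW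
  obtain ⟨W₀, hW₀, h₀⟩ := h W (hW b hb)
  exact ⟨W₀, hW₀, fun x hx => by rwa [Set.mem_singleton_iff.mp hx]⟩

theorem wbS.mono_right {U A B : Set S} (h : wbS cov U A) (hAB : A ⊆ B) :
    wbS cov U B :=
  fun W hW => h W fun a ha => hW a (hAB ha)

theorem IsBasicCover.wbS_of_cov (hbc : IsBasicCover cov) {a : S} {C : Finset S} {B : Set S}
    (h : cov a ↑C) (hC : ∀ c ∈ C, wbS cov {c} B) : wbS cov {a} B := by
  intro W hW
  choose! f hfW hf using fun c hc => hC c hc W hW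
  refine ⟨C.biUnion f, ?_, ?_⟩
  · intro x hx
    obtain ⟨c, hc, hx⟩ := Finset.mem_biUnion.mp (Finset.mem_coe.mp hx)
    exact hfW c hc hx
  · rintro _ rfl
    refine hbc.2 _ _ _ h fun c hc => hbc.mono (hf c hc c rfl) ?_
    exact_mod_cast Finset.subset_biUnion_of_mem f hc

theorem IsBasicCover.exists_wbS_interpolant (hbc : IsBasicCover cov) {w : S → Set S}
    (hw : IsContinuous cov w) {a : S} {A : Set S} (h : wbS cov {a} A) :
    ∃ B : Finset S, wbS cov {a} ↑B ∧ ∀ b ∈ B, ∃ c ∈ A, wb cov b c := by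
  obtain ⟨C, hCW, hC⟩ := h {c | ∃ b, wb cov c b ∧ ∃ d ∈ A, wb cov b d} fun d hd =>
    hbc.2 d _ _ (hw.2 d) fun b hb => hbc.mono (hw.2 b) fun c hc =>
      ⟨b, hw.1 b c hc, d, hd, hw.1 d b hb⟩
  choose! f hf hfA using fun c (hc : c ∈ C) => hCW hc
  refine ⟨C.image f, hbc.wbS_of_cov (hC a rfl) fun c hc =>
    (hf c hc).wbS_of_mem (Finset.mem_coe.mpr (Finset.mem_image_of_mem f hc)), fun b hb => ?_⟩
  obtain ⟨c, hc, rfl⟩ := Finset.mem_image.mp hb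
  exact hfA c hc

theorem Located.isCut (hbc : IsBasicCover cov) {w : S → Set S} (hw : IsContinuous cov w)
    {V : Set S} (hV : Located cov V) : IsCut cov (LV cov V) V := by
  refine ⟨fun a A h ha => ?_, fun a ha => ?_, fun a A h hA => ?_, ?_, fun a b h => ?_, ?_⟩
  · rw [Set.inter_comm]
    exact hV.1 a A ha h
  · obtain ⟨b, hbV, hb⟩ := hV.1 a (w a) ha (hw.2 a)
    exact ⟨b, hw.1 a b hb, hbV⟩
  · choose! f hf hfV using fun b (hb : b ∈ A) => hA hb
    refine ⟨A.biUnion f, hbc.wbS_of_cov h fun b hb => (hf b hb).mono_right ?_, ?_⟩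
    · exact_mod_cast Finset.subset_biUnion_of_mem f hb
    · refine Set.eq_empty_of_forall_notMem ?_
      rintro x ⟨hx, hxV⟩
      obtain ⟨b, hb, hx⟩ := Finset.mem_biUnion.mp (Finset.mem_coe.mp hx)
      exact (hfV b hb).le ⟨hx, hxV⟩
  · rintro a ⟨A, hA, hAV⟩
    obtain ⟨B, hB, hBA⟩ := hbc.exists_wbS_interpolant hw hA
    refine ⟨B, hB, fun b hb => ?_⟩
    obtain ⟨c, hc, hbc'⟩ := hBA b hb
    refine ⟨{c}, hbc'.wbS_of_mem (by simp), Set.eq_empty_of_forall_notMem ?_⟩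
    rintro x ⟨hx, hxV⟩
    obtain rfl : x = c := by simpa using hx
    exact hAV.le ⟨hc, hxV⟩
  · by_cases hb : b ∈ V
    · exact Or.inr hb
    · exact Or.inl ⟨{b}, h.wbS_of_mem (by simp), by simpa using hb⟩
  · refine Set.eq_empty_of_forall_notMem ?_
    rintro a ⟨⟨A, hA, hAV⟩, ha⟩
    obtain ⟨x, hxV, hxA⟩ := hV.1 a A ha (hbc.cov_of_wbS hA)
    exact hAV.le ⟨hxA, hxV⟩

theorem IsCut.located {L U : Set S} (h : IsCut cov L U) : Located cov U := by
  obtain ⟨h1, h2, -, -, h5, h6⟩ := h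
  refine ⟨fun a W ha hW => ?_, fun a b hab => (h5 a b hab).imp_left fun hL hU => h6.le ⟨hL, hU⟩⟩
  obtain ⟨b, hba, hb⟩ := h2 a ha
  obtain ⟨W₀, hW₀, hbW⟩ := hba W hW
  obtain ⟨x, hx, hxU⟩ := h1 b W₀ hbW hb
  exact ⟨x, hxU, hW₀ hx⟩

theorem IsCut.LV_eq (hbc : IsBasicCover cov) {w : S → Set S} (hw : IsContinuous cov w)
    {L U : Set S} (h : IsCut cov L U) : LV cov U = L := by
  obtain ⟨-, -, h3, h4, h5, h6⟩ := h
  refine Set.Subset.antisymm ?_ fun a ha => ?_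
  · rintro a ⟨A, hA, hAU⟩
    obtain ⟨B, hB, hBA⟩ := hbc.exists_wbS_interpolant hw hA
    refine h3 a B (hbc.cov_of_wbS hB) fun b hb => ?_
    obtain ⟨c, hc, hb_c⟩ := hBA b hb
    exact (h5 b c hb_c).resolve_right fun hcU => hAU.le ⟨hc, hcU⟩
  · obtain ⟨A, hA, hAL⟩ := h4 a ha
    exact ⟨A, hA, Set.eq_empty_of_forall_notMem fun x hx => h6.le ⟨hAL hx.1, hx.2⟩⟩

end

/-- The assignment `V ↦ (L_V, V)` is a bijective correspondence
between the located subsets of a continuous basic cover `(S, ◁)` and its cuts. -/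
theorem located_equiv_cuts {S : Type u} (cov : S → Set S → Prop)
    (hbc : IsBasicCover cov) (w : S → Set S) (hw : IsContinuous cov w) :
    Function.Injective
      (fun V : {V : Set S // Located cov V} => ((LV cov V.1, V.1) : Set S × Set S)) ∧
    Set.range
      (fun V : {V : Set S // Located cov V} => ((LV cov V.1, V.1) : Set S × Set S)) =
      {p : Set S × Set S | IsCut cov p.1 p.2} := by
  refine ⟨fun V V' h => Subtype.ext (congrArg Prod.snd h), Set.Subset.antisymm ?_ ?_⟩
  · rintro _ ⟨V, rfl⟩
    exact V.2.isCut hbc hw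
  · rintro ⟨L, U⟩ h
    exact ⟨⟨U, IsCut.located h⟩, Prod.ext (IsCut.LV_eq hbc hw h) rfl⟩

end FTP
end
end

section
/- Every locally compact regular formal topology is stably locally compact; that is, if S is a formal topology whose underlying basic cover is continuous and which is regular, then a ≪ a′ and b ≪ b′ imply a↓b ≪ a′↓b′ for all a, a′, b, b′ ∈ S. -/
noncomputable section
open Classical

universe u v

namespace FTP

namespace IsFormalTopology

variable {S : Type*} {cov : S → Set S → Prop} {le : S → S → Prop}

theorem cov_of_mem (h : IsFormalTopology cov le) {a : S} {U : Set S} (ha : a ∈ U) : cov a U :=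
  h.1.1 a U ha

theorem cov_trans (h : IsFormalTopology cov le) {a : S} {U V : Set S} (haU : cov a U)
    (hUV : covS cov U V) : cov a V :=
  h.1.2 a U V haU hUV

theorem le_trans (h : IsFormalTopology cov le) {a b c : S} (hab : le a b) (hbc : le b c) :
    le a c :=
  h.2.2.1 hab hbc

theorem cov_of_le (h : IsFormalTopology cov le) {a b : S} {U : Set S} (hab : le a b)
    (hb : cov b U) : cov a U :=
  h.cov_trans (h.2.2.2.1 a b hab) (by rintro _ rfl; exact hb)

theorem cov_of_down (h : IsFormalTopology cov le) {a : S} {U V W : Set S} (hU : cov a U)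
    (hV : cov a V) (hW : ∀ c, ∀ x ∈ U, ∀ y ∈ V, le c x → le c y → cov c W) : cov a W :=
  h.cov_trans (h.2.2.2.2 a U V hU hV) fun c ⟨x, hx, y, hy, hcx, hcy⟩ => hW c x hx y hy hcx hcy

theorem star_of_le_left (h : IsFormalTopology cov le) {b c d : S} (hdc : le d c)
    (hc : c ∈ star cov le b) : d ∈ star cov le b := by
  rintro e ⟨_, rfl, _, rfl, h₁, h₂⟩
  exact hc e ⟨c, rfl, _, rfl, h.le_trans h₁ hdc, h₂⟩

theorem star_of_le_right (h : IsFormalTopology cov le) {a b c : S} (hab : le a b)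
    (hc : c ∈ star cov le b) : c ∈ star cov le a := by
  rintro e ⟨_, rfl, _, rfl, h₁, h₂⟩
  exact hc e ⟨_, rfl, b, rfl, h₁, h.le_trans h₂ hab⟩

/-- `⋂_{b ∈ U} b* ⊆ a*` whenever `a ◁ U`. -/
theorem star_of_cov (h : IsFormalTopology cov le) {a c : S} {U : Set S} (ha : cov a U)
    (hc : ∀ b ∈ U, c ∈ star cov le b) : c ∈ star cov le a := by
  rintro e ⟨_, rfl, _, rfl, hec, hea⟩
  refine h.cov_of_down (h.cov_of_le hea ha) (h.cov_of_le hec (h.cov_of_mem rfl)) ?_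
  rintro d b hb _ rfl hdb hdc
  exact hc b hb d ⟨_, rfl, b, rfl, hdc, hdb⟩

/-- Finitely many elements well covered by `a` are simultaneously well covered by `a`. -/
theorem cov_iInter_star (h : IsFormalTopology cov le) {a : S} (F : Finset S)
    (hF : ∀ b ∈ F, wc cov le b a) (s : S) :
    cov s ({c | ∀ b ∈ F, c ∈ star cov le b} ∪ {a}) := by
  induction F using Finset.induction_on with
  | empty => exact h.cov_of_mem (Or.inl (by simp))
  | insert b F _ ih =>
    refine h.cov_of_down (ih fun b hb => hF b (Finset.mem_insert_of_mem hb))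
      (hF b (Finset.mem_insert_self b F) s trivial) ?_
    rintro c x (hx | rfl) y (hy | rfl) hcx hcy
    · refine h.cov_of_mem (Or.inl fun d hd => ?_)
      rcases Finset.mem_insert.1 hd with rfl | hd
      · exact h.star_of_le_left hcy hy
      · exact h.star_of_le_left hcx (hx d hd)
    · exact h.cov_of_le hcy (h.cov_of_mem (Or.inr rfl))
    · exact h.cov_of_le hcx (h.cov_of_mem (Or.inr rfl))
    · exact h.cov_of_le hcy (h.cov_of_mem (Or.inr rfl))

/-- In a regular formal topology the way-below relation is contained in the well-covered one. -/
theorem wc_of_wb (h : IsFormalTopology cov le) (hreg : Regular cov le) {a a' : S}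
    (ha : wb cov a a') : wc cov le a a' := by
  obtain ⟨F, hF, haF⟩ := ha _ (hreg a')
  refine fun s _ => h.cov_trans (h.cov_iInter_star F (fun b hb => hF hb) s) ?_
  rintro c (hc | hc)
  · exact h.cov_of_mem (Or.inl (h.star_of_cov haF hc))
  · exact h.cov_of_mem (Or.inr hc)

/-- The well-covered relation is stable under `↓`. -/
theorem cov_star_down (h : IsFormalTopology cov le) {a a' b b' : S} (ha : wc cov le a a')
    (hb : wc cov le b b') (s : S) :
    cov s ({c | ∀ d ∈ down le {a} {b}, c ∈ star cov le d} ∪ down le {a'} {b'}) := by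
  have hleft : ∀ c ∈ star cov le a, ∀ d ∈ down le {a} {b}, c ∈ star cov le d := by
    rintro c hc d ⟨_, rfl, _, _, hda, _⟩
    exact h.star_of_le_right hda hc
  have hright : ∀ c ∈ star cov le b, ∀ d ∈ down le {a} {b}, c ∈ star cov le d := by
    rintro c hc d ⟨_, _, _, rfl, _, hdb⟩
    exact h.star_of_le_right hdb hc
  refine h.cov_of_down (ha s trivial) (hb s trivial) ?_
  rintro c x (hx | rfl) y hy hcx hcy
  · exact h.cov_of_mem (Or.inl (hleft c (h.star_of_le_left hcx hx)))
  · rcases hy with hy | rfl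
    · exact h.cov_of_mem (Or.inl (hright c (h.star_of_le_left hcy hy)))
    · exact h.cov_of_mem (Or.inr ⟨_, rfl, _, rfl, hcx, hcy⟩)

/-- If `d ◁ V` then the members of `V` lying in `d*` can be discarded. -/
theorem cov_of_mem_star_or (h : IsFormalTopology cov le) {d : S} {V W : Set S} (hd : cov d V)
    (hV : ∀ z ∈ V, z ∈ star cov le d ∨ z ∈ W) : cov d W := by
  refine h.cov_of_down hd (h.cov_of_mem (Set.mem_singleton d)) ?_
  rintro c z hz _ rfl hcz hcd
  rcases hV z hz with hz | hz
  · exact h.cov_trans (hz c ⟨z, rfl, _, rfl, hcz, hcd⟩) fun _ => False.elim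
  · exact h.cov_of_le hcz (h.cov_of_mem hz)

end IsFormalTopology

/-- Every locally compact regular formal topology is stably
locally compact. -/
theorem locally_compact_regular_stably_locally_compact {S : Type u}
    (cov : S → Set S → Prop) (le : S → S → Prop)
    (hft : IsFormalTopology cov le) (w : S → Set S) (hw : IsContinuous cov w)
    (hreg : Regular cov le) :
    ∀ a a' b b' : S, wb cov a a' → wb cov b b' →
      wbS cov (down le {a} {b}) (down le {a'} {b'}) := by
  intro a a' b b' ha hb W hW
  have hcov : cov a' ({c | ∀ d ∈ down le {a} {b}, c ∈ star cov le d} ∪ W) := by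
    refine hft.cov_trans
      (hft.cov_star_down (hft.wc_of_wb hreg ha) (hft.wc_of_wb hreg hb) a') ?_
    rintro c (hc | hc)
    · exact hft.cov_of_mem (Or.inl hc)
    · exact hft.cov_trans (hW c hc) fun _ hx => hft.cov_of_mem (Or.inr hx)
  obtain ⟨Z, hZ, haZ⟩ := ha _ hcov
  refine ⟨Z.filter (· ∈ W), fun z hz => (Finset.mem_filter.1 hz).2, fun d hd => ?_⟩
  obtain ⟨_, rfl, _, _, hda, _⟩ := id hd
  refine hft.cov_of_mem_star_or (hft.cov_of_le hda haZ) fun z hz => ?_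
  exact (hZ hz).imp (fun hz' => hz' d hd) fun hz' => Finset.mem_filter.2 ⟨hz, hz'⟩

end FTP
end
end
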